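/- arXiv:1103.4193 — 4 statements merged into one kernel-verified Lean document; each statement's English description precedes it below -/
import Mathlib

section
/- Let A, B, C be groups with injective homomorphisms φ_A : C → A and φ_B : C → B, let G = A *_C B be the amalgamated free product, and let ι_A : A → G and ι_B : B → G be the canonical homomorphisms. If K is a subgroup of G such that K ∩ g·ι_A(A)·g⁻¹ = {1} and K ∩ g·ι_B(B)·g⁻¹ = {1} for every g ∈ G, then K is a free group. -/
section FreeAction

open CategoryTheory

universe u

/-- The orbits of an action of `K` on `V`, seen as the objects of a groupoid all of whose hom sets
are `K`. When `V` is the vertex set of a tree on which `K` acts freely, this is the fundamental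
groupoid of the quotient graph: after choosing a representative of every orbit, the morphism
`k : q ⟶ r` stands for the class of the path from `k • q.out` to `r.out`. -/
def OrbitGroupoid (K V : Type u) [Group K] [MulAction K V] : Type u :=
  MulAction.orbitRel.Quotient K V

namespace OrbitGroupoid

variable {K V : Type u} [Group K] [MulAction K V]

instance : Groupoid (OrbitGroupoid K V) where
  Hom _ _ := K
  id _ := (1 : K)
  comp f g := (g * f : K)
  inv f := (f⁻¹ : K)
  id_comp := mul_one (M := K)
  comp_id := one_mul (M := K)
  assoc f g h := (mul_assoc (G := K) h g f).symm
  inv_comp := mul_inv_cancel (G := K)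
  comp_inv := inv_mul_cancel (G := K)

/-- An element of the group, as a morphism between two given objects. -/
def hom (q r : OrbitGroupoid K V) (k : K) : q ⟶ r := k

/-- The orbit of a vertex. -/
def mk (v : V) : OrbitGroupoid K V := Quotient.mk (MulAction.orbitRel K V) v

/-- A representative of an orbit. -/
noncomputable def out (q : OrbitGroupoid K V) : V :=
  Quotient.out (s := MulAction.orbitRel K V) q

lemma mk_out (q : OrbitGroupoid K V) : mk q.out = q :=
  Quotient.out_eq (s := MulAction.orbitRel K V) q

lemma mk_smul (k : K) (v : V) : mk (K := K) (k • v) = mk v :=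
  Quotient.sound (s := MulAction.orbitRel K V) ⟨k, rfl⟩

lemma exists_smul_out (v : V) : ∃ k : K, k • (mk (K := K) v).out = v :=
  (MulAction.orbitRel K V).symm (Quotient.mk_out (s := MulAction.orbitRel K V) v)

variable (K) in
/-- An element carrying the representative of the orbit of `v` to `v`. -/
noncomputable def coord (v : V) : K := (exists_smul_out (K := K) v).choose

lemma coord_smul_out (v : V) : coord K v • (mk (K := K) v).out = v :=
  (exists_smul_out (K := K) v).choose_spec

lemma coord_inv_smul (v : V) : (coord K v)⁻¹ • v = (mk (K := K) v).out := by
  rw [inv_smul_eq_iff, coord_smul_out]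

lemma coord_smul (hfree : ∀ (k : K) (v : V), k • v = v → k = 1) (k : K) (v : V) :
    coord K (k • v) = k * coord K v := by
  rw [← inv_mul_eq_one]
  refine hfree _ (mk (K := K) v).out ?_
  have h := coord_smul_out (K := K) (k • v)
  rw [mk_smul] at h
  rw [mul_smul, inv_smul_eq_iff, h, mul_smul, coord_smul_out]

lemma coord_out (hfree : ∀ (k : K) (v : V), k • v = v → k = 1) (q : OrbitGroupoid K V) :
    coord K q.out = 1 := by
  refine hfree _ q.out ?_
  have h := coord_smul_out (K := K) q.out
  rwa [mk_out] at h

/-- The multiplication of the vertex groups of `OrbitGroupoid K V` is that of `K`. -/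
def endEquiv (q : OrbitGroupoid K V) : End q ≃* K where
  toFun k := k
  invFun k := k
  left_inv _ := rfl
  right_inv _ := rfl
  map_mul' _ _ := rfl

instance [Nonempty V] : IsConnected (OrbitGroupoid K V) :=
  have : Nonempty (OrbitGroupoid K V) := Nonempty.map mk ‹_›
  zigzag_isConnected fun q r => Zigzag.of_hom (hom q r 1)

/-- The value of a functor on the class of the path from `v` to `w`. -/
noncomputable def pathValue {X : Type u} [Group X]
    (F : OrbitGroupoid K V ⥤ SingleObj X) (v w : V) : X :=
  F.map (hom (mk v) (mk w) ((coord K w)⁻¹ * coord K v))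

lemma pathValue_mul {X : Type u} [Group X] (F : OrbitGroupoid K V ⥤ SingleObj X) (u v w : V) :
    pathValue F v w * pathValue F u v = pathValue F u w := by
  have h : hom (mk u) (mk w) ((coord K w)⁻¹ * coord K u) =
      hom (mk u) (mk v) ((coord K v)⁻¹ * coord K u) ≫
        hom (mk v) (mk w) ((coord K w)⁻¹ * coord K v) :=
    show (coord K w)⁻¹ * coord K u =
      ((coord K w)⁻¹ * coord K v) * ((coord K v)⁻¹ * coord K u) by group
  unfold pathValue
  rw [h, F.map_comp]
  rfl

lemma map_hom_congr {X : Type u} [Group X] (F : OrbitGroupoid K V ⥤ SingleObj X)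
    {q q' r r' : OrbitGroupoid K V} {k k' : K} (hq : q = q') (hr : r = r') (hk : k = k') :
    (F.map (hom q r k) : X) = F.map (hom q' r' k') := by
  subst hq hr hk
  rfl

lemma pathValue_smul_out (hfree : ∀ (k : K) (v : V), k • v = v → k = 1) {X : Type u} [Group X]
    (F : OrbitGroupoid K V ⥤ SingleObj X) {q r : OrbitGroupoid K V} (k : K) :
    pathValue F (k • q.out) r.out = (F.map (hom q r k) : X) := by
  refine map_hom_congr F ?_ (mk_out r) ?_
  · rw [mk_smul, mk_out]
  · rw [coord_smul hfree, coord_out hfree, coord_out hfree, inv_one, one_mul, mul_one]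

end OrbitGroupoid

open OrbitGroupoid in
/-- A group `K` acting freely on a tree is free. Being a tree is expressed through labellings:
the graph with vertices `V` and edges `E` (from `s e` to `t e`) is connected when functions on `V`
that agree on the ends of every edge are constant, and it has no cycles when every labelling of
the edges by elements of a group is a coboundary. The edges ending in a chosen representative of
a vertex orbit represent the edge orbits, and so they generate the fundamental groupoid of the
quotient graph freely. -/
theorem isFreeGroup_of_free_action {K V E : Type u} [Group K] [MulAction K V] [MulAction K E]
    [Nonempty V] (s t : E → V)
    (hs : ∀ (k : K) (e : E), s (k • e) = k • s e) (ht : ∀ (k : K) (e : E), t (k • e) = k • t e)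
    (hfree : ∀ (k : K) (v : V), k • v = v → k = 1)
    (hconn : ∀ (X : Type u) [Group X] (α : V → X), (∀ e, α (s e) = α (t e)) → ∀ v w, α v = α w)
    (hlabel : ∀ (X : Type u) [Group X] (l : E → X),
      ∃ α : V → X, ∀ e, α (t e) * (α (s e))⁻¹ = l e) :
    IsFreeGroup K := by
  let v₀ : V := Classical.arbitrary V
  let : IsFreeGroupoid (OrbitGroupoid K V) := {
    quiverGenerators := ⟨fun q r => {e : E // mk (s e) = q ∧ t e = out r}⟩
    of := fun {q r} e => hom q r (coord K (s e.1))
    unique_lift := by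
      intro X _ f
      have rigid : ∀ α β : V → X,
          (∀ e, α (t e) * (α (s e))⁻¹ = β (t e) * (β (s e))⁻¹) →
          ∀ v w, α w * (α v)⁻¹ = β w * (β v)⁻¹ := by
        intro α β h v w
        have := hconn X (fun v => (β v)⁻¹ * α v) (fun e => by
          have h := h e
          rw [mul_inv_eq_iff_eq_mul] at h
          simp only [h]
          group) w v
        rw [inv_mul_eq_iff_eq_mul] at this
        rw [this]
        group
      let g : (e : E) → t e = out (K := K) (mk (t e)) → X := fun e h =>
        f (a := (mk (s e) : OrbitGroupoid K V)) (b := (mk (t e) : OrbitGroupoid K V)) ⟨e, rfl, h⟩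
      have f_eq : ∀ (q r : OrbitGroupoid K V) (e : E) (h : mk (s e) = q ∧ t e = out r),
          f (a := q) (b := r) ⟨e, h⟩ = g e (by rw [h.2, mk_out]) := by
        rintro q r e ⟨rfl, h⟩
        obtain rfl : r = mk (t e) := by rw [h, mk_out]
        rfl
      have g_congr : ∀ {e e' : E} (h : t e = out (K := K) (mk (t e)))
          (h' : t e' = out (K := K) (mk (t e'))), e = e' → g e h = g e' h' := by
        rintro e _ _ _ rfl
        rfl
      have ht' : ∀ e, t ((coord K (t e))⁻¹ • e) = out (K := K) (mk (t e)) := fun e => by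
        rw [ht, coord_inv_smul]
      have hmk : ∀ e, t ((coord K (t e))⁻¹ • e) =
          out (K := K) (mk (t ((coord K (t e))⁻¹ • e))) := fun e => by
        rw [ht', mk_out]
      let l : E → X := fun e => g ((coord K (t e))⁻¹ • e) (hmk e)
      have l_smul : ∀ (k : K) (e : E), l (k • e) = l e := fun k e => by
        refine g_congr (hmk _) (hmk _) ?_
        rw [ht, coord_smul hfree, mul_inv_rev, mul_smul, inv_smul_smul]
      obtain ⟨α, hα⟩ := hlabel X l
      have α_smul : ∀ (k : K) (v w : V), α (k • w) * (α (k • v))⁻¹ = α w * (α v)⁻¹ := fun k =>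
        rigid (fun v => α (k • v)) α fun e => by
          simp only [← hs, ← ht, hα, l_smul]
      let F : OrbitGroupoid K V ⥤ SingleObj X :=
        { obj := fun _ => SingleObj.star X
          map := fun {q r} (k : K) => (α r.out * (α (k • q.out))⁻¹ : X)
          map_id := fun q => by
            change α q.out * (α ((1 : K) • q.out))⁻¹ = (1 : X)
            rw [one_smul, mul_inv_cancel]
          map_comp := fun {p q r} (h k : K) => by
            change α r.out * (α ((k * h) • p.out))⁻¹ =
              (α r.out * (α (k • q.out))⁻¹) * (α q.out * (α (h • p.out))⁻¹)
            rw [← α_smul k (h • p.out) q.out, mul_smul]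
            group }
      have hF : ∀ (q r : OrbitGroupoid K V) (e : E) (h : mk (s e) = q ∧ t e = out r),
          α r.out * (α (coord K (s e) • q.out))⁻¹ = f (a := q) (b := r) ⟨e, h⟩ := by
        intro q r e h
        have hsrc : coord K (s e) • q.out = s e := by rw [← h.1, coord_smul_out]
        have hval : α r.out * (α (s e))⁻¹ = l e := by rw [← hα, h.2]
        rw [hsrc, hval, f_eq]
        refine g_congr (hmk e) (by rw [h.2, mk_out]) ?_
        rw [h.2, coord_out hfree, inv_one, one_smul]
      refine ⟨F, fun q r e => hF q r e.1 e.2, ?_⟩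
      · intro F' hF'
        refine Functor.hext (fun _ => rfl) fun q r k => heq_of_eq ?_
        have hpath : ∀ e, pathValue F' (s e) (t e) = l e := fun e => by
          have h := hF' (mk (s e)) (mk (t e)) ⟨(coord K (t e))⁻¹ • e, by rw [hs, mk_smul], ht' e⟩
          rw [f_eq] at h
          refine Eq.trans (map_hom_congr F' rfl rfl ?_) h
          rw [hs, coord_smul hfree]
        have hdiff : ∀ v w,
            pathValue F' v₀ w * (pathValue F' v₀ v)⁻¹ = pathValue F' v w := fun v w => by
          rw [← pathValue_mul F' v₀ v w, mul_inv_cancel_right]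
        refine (pathValue_smul_out hfree F' k).symm.trans ?_
        rw [← hdiff]
        exact rigid (pathValue F' v₀) α (fun e => by rw [hdiff, hpath, hα]) _ _ }
  have : IsFreeGroup (End (mk (K := K) v₀)) := IsFreeGroupoid.endIsFreeOfConnectedFree _
  exact IsFreeGroup.ofMulEquiv (endEquiv (mk (K := K) v₀))

end FreeAction

namespace Monoid.PushoutI

universe u₁ u₂

variable {G : Bool → Type u₁} [∀ b, Group (G b)] {C : Type u₂} [Group C] (φ : ∀ b, C →* G b)

lemma base_range_le_of_range (b : Bool) :
    (base φ).range ≤ (of (φ := φ) b).range := by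
  rintro _ ⟨c, rfl⟩
  exact ⟨φ b c, of_apply_eq_base φ b c⟩

/-- The vertices of the Bass-Serre tree of an amalgamated product. -/
abbrev TreeVertex : Type (max u₁ u₂) := Σ b : Bool, PushoutI φ ⧸ (of (φ := φ) b).range

/-- The edges of the Bass-Serre tree of an amalgamated product. -/
abbrev TreeEdge : Type (max u₁ u₂) := PushoutI φ ⧸ (base φ).range

/-- The ends of an edge of the Bass-Serre tree. -/
def treeEnd (b : Bool) (e : TreeEdge φ) : TreeVertex φ :=
  ⟨b, Subgroup.quotientMapOfLE (base_range_le_of_range φ b) e⟩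

lemma treeEnd_smul (b : Bool) (g : PushoutI φ) (e : TreeEdge φ) :
    treeEnd φ b (g • e) = g • treeEnd φ b e := by
  induction e using QuotientGroup.induction_on
  rfl

lemma treeVertex_mk_mul_of (b : Bool) (g : PushoutI φ) (x : G b) :
    (⟨b, (g * of b x : PushoutI φ)⟩ : TreeVertex φ) = ⟨b, g⟩ := by
  rw [QuotientGroup.mk_mul_of_mem g (MonoidHom.mem_range.2 ⟨x, rfl⟩)]

lemma tree_connected {X : Type*} (α : TreeVertex φ → X)
    (h : ∀ e, α (treeEnd φ false e) = α (treeEnd φ true e)) (v w : TreeVertex φ) : α v = α w := by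
  have hends : ∀ (b : Bool) (g : PushoutI φ), α ⟨b, g⟩ = α ⟨true, g⟩ := fun b g => by
    cases b
    · exact h g
    · rfl
  have hmul : ∀ g h : PushoutI φ, α ⟨true, (h * g : PushoutI φ)⟩ = α ⟨true, h⟩ := by
    intro g
    induction g using induction_on with
    | of b x =>
      intro h
      rw [← hends b, treeVertex_mk_mul_of, hends]
    | base c =>
      intro h
      rw [← of_apply_eq_base φ true, treeVertex_mk_mul_of]
    | mul x y hx hy =>
      intro h
      rw [← mul_assoc, hy, hx]
  have hone : ∀ v, α v = α ⟨true, (1 : PushoutI φ)⟩ := by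
    rintro ⟨b, v⟩
    induction v using QuotientGroup.induction_on with
    | H g => rw [hends, ← hmul g 1, one_mul]
  rw [hone, hone w]

/-- Every labelling of the edges of the Bass-Serre tree is a coboundary. The label of the path
between two vertices is obtained from a homomorphism to a semidirect product, which exists by the
universal property of the pushout. -/
lemma tree_label_eq_coboundary {X : Type*} [Group X] (l : TreeEdge φ → X) :
    ∃ α : TreeVertex φ → X, ∀ e, α (treeEnd φ true e) * (α (treeEnd φ false e))⁻¹ = l e := by
  let m : (PushoutI φ → X) ⋊[mulAutArrow] PushoutI φ :=
    SemidirectProduct.inl fun x => l (x⁻¹ : PushoutI φ)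
  have smul_apply : ∀ (g x : PushoutI φ) (f : PushoutI φ → X),
      mulAutArrow (M := X) g f x = f (g⁻¹ * x) := fun _ _ _ => rfl
  have l_mul_base : ∀ (g : PushoutI φ) (c : C), l (g * base φ c : PushoutI φ) = l g :=
    fun g c => by rw [QuotientGroup.mk_mul_of_mem g (MonoidHom.mem_range.2 ⟨c, rfl⟩)]
  have hbase : ∀ c, m * SemidirectProduct.inr (base φ c) * m⁻¹ =
      SemidirectProduct.inr (base φ c) := fun c => by
    rw [mul_inv_eq_iff_eq_mul]
    ext x
    · simp [m, smul_apply]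
    · simp [m]
  let conjOf : ∀ b, G b →* (PushoutI φ → X) ⋊[mulAutArrow] PushoutI φ := fun b =>
    (bif b then MonoidHom.id _ else (MulAut.conj m).toMonoidHom).comp
      (SemidirectProduct.inr.comp (of b))
  let Ψ : PushoutI φ →* (PushoutI φ → X) ⋊[mulAutArrow] PushoutI φ :=
    lift conjOf (SemidirectProduct.inr.comp (base φ)) fun b => by
    ext1 c
    cases b
    · simpa [conjOf, of_apply_eq_base] using hbase c
    · simp [conjOf, of_apply_eq_base]
  have hΨ : ∀ g, (Ψ g).right = g := by
    intro g
    have : SemidirectProduct.rightHom.comp Ψ = MonoidHom.id _ := by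
      ext b x
      cases b <;> simp [Ψ, conjOf, m]
    exact DFunLike.congr_fun this g
  have left_mul : ∀ g h : PushoutI φ, (Ψ (g * h)).left 1 = (Ψ g).left 1 * (Ψ h).left g⁻¹ :=
    fun g h => by
      rw [map_mul, SemidirectProduct.mul_left, Pi.mul_apply, hΨ, smul_apply, mul_one]
  have left_true : ∀ (x : G true) (y : PushoutI φ), (Ψ (of true x)).left y = 1 := fun x y => by
    simp [Ψ, conjOf]
  have left_false : ∀ (x : G false) (y : PushoutI φ),
      (Ψ (of false x)).left y⁻¹ = l y * (l (y * of false x : PushoutI φ))⁻¹ := fun x y => by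
    simp [Ψ, conjOf, m, smul_apply]
  let α : ∀ b, (PushoutI φ ⧸ (of (φ := φ) b).range) → X := fun b => Quotient.lift
    (fun g : PushoutI φ => bif b then ((Ψ g).left 1)⁻¹ else (l g)⁻¹ * ((Ψ g).left 1)⁻¹) <| by
      intro g h hgh
      obtain ⟨x, hx⟩ := QuotientGroup.leftRel_apply.1 hgh
      obtain rfl : h = g * of b x := by rw [hx, mul_inv_cancel_left]
      cases b
      · simp only [cond_false, left_mul, left_false]
        group
      · simp only [cond_true, left_mul, left_true, mul_one]
  refine ⟨fun v => α v.1 v.2, fun e => ?_⟩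
  induction e using QuotientGroup.induction_on with
  | H g =>
    change ((Ψ g).left 1)⁻¹ * ((l g)⁻¹ * ((Ψ g).left 1)⁻¹)⁻¹ = l g
    group

end Monoid.PushoutI

/-- A subgroup of an amalgamated free product `A *_C B`
(`A = G true`, `B = G false`) meeting every conjugate of each factor trivially
is a free group. -/
theorem subgroup_of_amalgam_avoiding_factors_is_free
    (G : Bool → Type*) [∀ b, Group (G b)]
    (C : Type*) [Group C] (φ : ∀ b, C →* G b)
    (hinj : ∀ b, Function.Injective (φ b))
    (K : Subgroup (Monoid.PushoutI φ))
    (hK : ∀ (g : Monoid.PushoutI φ) (b : Bool),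
      K ⊓ Subgroup.map (MulAut.conj g).toMonoidHom
        (Monoid.PushoutI.of (φ := φ) b).range = ⊥) :
    IsFreeGroup K := by
  have smul_eq : ∀ (k : K) (v : Monoid.PushoutI.TreeVertex φ), k • v = v → k = 1 := by
    rintro k ⟨b, v⟩ h
    induction v using QuotientGroup.induction_on with
    | H g =>
      have h' : ((k * g : Monoid.PushoutI φ) : Monoid.PushoutI φ ⧸
          (Monoid.PushoutI.of (φ := φ) b).range) = g := eq_of_heq (Sigma.mk.inj h).2
      have hmem := inv_mem (QuotientGroup.eq.1 h')
      refine Subtype.ext ((Subgroup.mem_bot).1 ?_)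
      rw [← hK g b]
      refine ⟨k.2, _, hmem, ?_⟩
      simp [mul_assoc]
  have : Nonempty (Monoid.PushoutI.TreeVertex φ) := ⟨⟨true, (1 : Monoid.PushoutI φ)⟩⟩
  exact isFreeGroup_of_free_action
    (Monoid.PushoutI.treeEnd φ false) (Monoid.PushoutI.treeEnd φ true)
    (fun k e => Monoid.PushoutI.treeEnd_smul φ false k e)
    (fun k e => Monoid.PushoutI.treeEnd_smul φ true k e)
    smul_eq (fun _ _ α => Monoid.PushoutI.tree_connected φ α)
    fun _ _ l => Monoid.PushoutI.tree_label_eq_coboundary φ l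
end

section
/- Every free group is residually solvable; that is, if F is a free group, then for every element g ≠ 1 of F there exists a solvable group S and a group homomorphism f : F → S with f(g) ≠ 1. -/
/-- A group `G` is residually solvable if every nontrivial element survives in
some solvable quotient. -/
def ResiduallySolvable (G : Type*) [Group G] : Prop :=
  ∀ g : G, g ≠ 1 → ∃ (S : Type) (_ : Group S), IsSolvable S ∧ ∃ f : G →* S, f g ≠ 1

namespace RegularWreathProduct

theorem isSolvable {D Q : Type*} [CommGroup D] [Group Q] [Group.IsSolvable Q] :
    Group.IsSolvable (D ≀ᵣ Q) := by
  let base : (Q → D) →* D ≀ᵣ Q :=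
    { toFun := fun f ↦ ⟨f, 1⟩
      map_one' := rfl
      map_mul' := fun f g ↦ by ext <;> simp }
  refine Group.isSolvable_of_ker_le_range base rightHom fun x hx ↦ ⟨x.left, ?_⟩
  ext
  · rfl
  · exact (MonoidHom.mem_ker.mp hx).symm

end RegularWreathProduct

/-- Finitely many elements that survive in solvable quotients survive in a common one. -/
theorem exists_isSolvable_forall_mem_map_ne_one {G : Type*} [Group G] {s : Set G}
    (hs : s.Finite)
    (h : ∀ g ∈ s, ∃ (S : Type) (_ : Group S), Group.IsSolvable S ∧ ∃ f : G →* S, f g ≠ 1) :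
    ∃ (S : Type) (_ : Group S), Group.IsSolvable S ∧ ∃ f : G →* S, ∀ g ∈ s, f g ≠ 1 := by
  induction s, hs using Set.Finite.induction_on with
  | empty => exact ⟨Unit, inferInstance, inferInstance, 1, by simp⟩
  | @insert g s _ _ ih =>
    obtain ⟨S, _, _, f, hf⟩ := ih fun x hx ↦ h x (Set.mem_insert_of_mem _ hx)
    obtain ⟨T, _, _, k, hk⟩ := h g (Set.mem_insert _ _)
    refine ⟨S × T, inferInstance, inferInstance, f.prod k, ?_⟩
    rintro x (rfl | hx) h1
    · exact hk (congrArg Prod.snd h1)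
    · exact hf x hx (congrArg Prod.fst h1)

namespace FreeGroup

variable {X S : Type*} [Group S]

open Classical in
/-- The element of `ℤˣ ≀ᵣ S` lying over `s` whose base component is `-1` exactly at `1`. -/
noncomputable def markedEdge (s : S) : ℤˣ ≀ᵣ S := ⟨fun x ↦ if x = 1 then -1 else 1, s⟩

open Classical in
/-- The lift of `φ` to `ℤˣ ≀ᵣ S` that records the parity of the number of times a word, read as a
path in the Cayley graph of `S`, runs through the translates of the edge labelled `(a, e)`. -/
noncomputable def edgeParity (φ : FreeGroup X →* S) (a : X) (e : Bool) :
    FreeGroup X →* ℤˣ ≀ᵣ S :=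
  lift fun b ↦
    if b = a then
      bif e then markedEdge (φ (mk [(a, e)])) else (markedEdge (φ (mk [(a, e)])))⁻¹
    else RegularWreathProduct.inl (φ (of b))

theorem mk_singleton_not (a : X) (e : Bool) : mk [(a, !e)] = (mk [(a, e)])⁻¹ := by
  simp [inv_mk, invRev]

theorem mk_cons (x : X × Bool) (L : List (X × Bool)) : mk (x :: L) = mk [x] * mk L := by
  simp [mul_mk]

theorem edgeParity_self (φ : FreeGroup X →* S) (a : X) (e : Bool) :
    edgeParity φ a e (mk [(a, e)]) = markedEdge (φ (mk [(a, e)])) := by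
  cases e <;> simp [edgeParity]

theorem edgeParity_of_ne (φ : FreeGroup X →* S) {a b : X} (e d : Bool) (hb : b ≠ a) :
    edgeParity φ a e (mk [(b, d)]) = RegularWreathProduct.inl (φ (mk [(b, d)])) := by
  have hof : mk [(b, true)] = of b := rfl
  have hinv : mk [(b, false)] = (of b)⁻¹ := mk_singleton_not b true
  cases d <;> simp [edgeParity, hb, hof, hinv]

theorem right_edgeParity_singleton (φ : FreeGroup X →* S) (a : X) (e : Bool) (x : X × Bool) :
    (edgeParity φ a e (mk [x])).right = φ (mk [x]) := by
  obtain ⟨b, d⟩ := x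
  by_cases hb : b = a
  · subst hb
    obtain rfl | rfl : d = e ∨ d = !e := by cases d <;> cases e <;> simp
    · rw [edgeParity_self]; rfl
    · rw [mk_singleton_not, _root_.map_inv, edgeParity_self, _root_.map_inv]; rfl
  · rw [edgeParity_of_ne φ e d hb]; rfl

/-- The parity at the translate of the edge by `h` is trivial if the path of the word `L` never
runs through that translate, in either direction. -/
theorem left_edgeParity_eq_one (φ : FreeGroup X →* S) (a : X) (e : Bool)
    (L : List (X × Bool)) (h : S)
    (hpos : ∀ P Q, L = P ++ (a, e) :: Q → φ (mk P) ≠ h)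
    (hneg : ∀ P Q, L = P ++ (a, !e) :: Q → φ (mk P) * (φ (mk [(a, e)]))⁻¹ ≠ h) :
    (edgeParity φ a e (mk L)).left h = 1 := by
  induction L generalizing h with
  | nil => simp [← one_eq_mk]
  | cons x L ih =>
    rw [mk_cons, _root_.map_mul, RegularWreathProduct.mul_left, Pi.mul_apply,
      right_edgeParity_singleton]
    have htail : (edgeParity φ a e (mk L)).left ((φ (mk [x]))⁻¹ * h) = 1 := by
      refine ih _ (fun P Q hL hP ↦ hpos (x :: P) Q (by simp [hL]) ?_)
        (fun P Q hL hP ↦ hneg (x :: P) Q (by simp [hL]) ?_)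
      · rw [mk_cons, _root_.map_mul, hP, mul_inv_cancel_left]
      · rw [mk_cons, _root_.map_mul, mul_assoc, hP, mul_inv_cancel_left]
    rw [htail, mul_one]
    obtain ⟨b, d⟩ := x
    by_cases hb : b = a
    · subst hb
      obtain rfl | rfl : d = e ∨ d = !e := by cases d <;> cases e <;> simp
      · have h1 := hpos [] L rfl
        rw [← one_eq_mk, _root_.map_one] at h1
        rw [edgeParity_self]
        exact if_neg h1.symm
      · have h1 := hneg [] L rfl
        rw [← one_eq_mk, _root_.map_one, one_mul] at h1
        rw [mk_singleton_not, _root_.map_inv, edgeParity_self, RegularWreathProduct.inv_left]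
        refine inv_eq_one.mpr (if_neg ?_)
        exact fun h2 ↦ h1 (inv_eq_of_mul_eq_one_right h2)
    · rw [edgeParity_of_ne φ e d hb]; rfl

theorem edgeParity_ne_one (φ : FreeGroup X →* S) {a : X} {e : Bool} {L : List (X × Bool)}
    (hL : IsReduced ((a, e) :: L))
    (hφ : ∀ P, P <:+: (a, e) :: L → P ≠ [] → P ≠ (a, e) :: L → φ (mk P) ≠ 1) :
    edgeParity φ a e (mk ((a, e) :: L)) ≠ 1 := by
  intro h1
  have h2 : (edgeParity φ a e (mk L)).left (φ (mk [(a, e)]))⁻¹ = 1 := by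
    refine left_edgeParity_eq_one φ a e L _ (fun P Q hPQ hP ↦ ?_) (fun P Q hPQ hP ↦ ?_)
    · refine hφ ((a, e) :: P) ⟨[], (a, e) :: Q, by simp [hPQ]⟩ (by simp) (by simp [hPQ]) ?_
      rw [mk_cons, _root_.map_mul, hP, mul_inv_cancel]
    · refine hφ P ⟨[(a, e)], (a, !e) :: Q, by simp [hPQ]⟩ ?_ ?_ (by simpa using hP)
      · rintro rfl
        subst hPQ
        simp [IsReduced] at hL
      · intro hP'
        have := congrArg List.length hPQ
        simp [hP'] at this
        omega
  have h3 := congrFun (congrArg RegularWreathProduct.left h1) 1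
  rw [mk_cons, _root_.map_mul, RegularWreathProduct.mul_left, Pi.mul_apply, right_edgeParity_singleton,
    mul_one, h2, edgeParity_self] at h3
  simp [markedEdge] at h3

theorem exists_isSolvable_map_mk_ne_one (L : List (X × Bool)) (hL : IsReduced L) (hne : L ≠ []) :
    ∃ (S : Type) (_ : Group S), Group.IsSolvable S ∧ ∃ f : FreeGroup X →* S, f (mk L) ≠ 1 := by
  induction hn : L.length using Nat.strong_induction_on generalizing L with
  | _ n ih =>
  have hfin : {P | P <:+: L ∧ P ≠ [] ∧ P ≠ L}.Finite :=
    (List.finite_toSet L.sublists).subset fun P hP ↦ List.mem_sublists.mpr hP.1.sublist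
  obtain ⟨S, _, _, φ, hφ⟩ := exists_isSolvable_forall_mem_map_ne_one (hfin.image mk) (by
    rintro _ ⟨P, ⟨hPL, hP, hPne⟩, rfl⟩
    have hlt : P.length < L.length :=
      lt_of_le_of_ne hPL.length_le fun h ↦ hPne (hPL.eq_of_length h)
    exact ih _ (hn ▸ hlt) P (hL.infix hPL) hP rfl)
  match L, hne with
  | (a, e) :: L, _ =>
    exact ⟨ℤˣ ≀ᵣ S, inferInstance, RegularWreathProduct.isSolvable, edgeParity φ a e,
      edgeParity_ne_one φ hL fun P hPL hP hPne ↦ hφ _ ⟨P, ⟨hPL, hP, hPne⟩, rfl⟩⟩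

end FreeGroup

/-- Every free group is residually solvable. -/
theorem free_group_residually_solvable (X : Type*) :
    ResiduallySolvable (FreeGroup X) := by
  classical
  intro g hg
  rw [← FreeGroup.mk_toWord (x := g)]
  exact FreeGroup.exists_isSolvable_map_mk_ne_one _ FreeGroup.isReduced_toWord
    (mt FreeGroup.toWord_eq_nil_iff.mp hg)
end

section
/- Let A be a finitely generated torsion-free abelian group and C a subgroup of A. Then there exists a subgroup A₁ of A of finite index such that C ≤ A₁ and C is a direct factor of A₁; that is, there exists a subgroup H of A₁ with A₁ = C × H internally (C and H generate A₁ and intersect trivially). -/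
theorem Subgroup.exists_maximal_disjoint {A : Type*} [Group A] (C : Subgroup A) :
    ∃ H : Subgroup A, Maximal (Disjoint C) H := by
  obtain ⟨H, -, hH⟩ := zorn_le_nonempty₀ {H : Subgroup A | Disjoint C H} (fun c hc hchain K hK => by
    refine ⟨sSup c, ?_, fun _ => le_sSup⟩
    change Disjoint C (sSup c)
    rw [Subgroup.disjoint_def]
    intro x hx hxc
    obtain ⟨L, hL, hxL⟩ := (Subgroup.mem_sSup_of_directedOn ⟨K, hK⟩ hchain.directedOn).1 hxc
    exact Subgroup.disjoint_def.1 (hc hL) hx hxL) ⊥ disjoint_bot_right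
  exact ⟨H, hH⟩

theorem Subgroup.isTorsion_quotient_sup_of_maximal_disjoint {A : Type*} [CommGroup A]
    {C H : Subgroup A} (hH : Maximal (Disjoint C) H) : IsMulTorsion (A ⧸ C ⊔ H) := by
  intro q
  induction q using QuotientGroup.induction_on with | H a => ?_
  by_cases ha : a ∈ H
  · rw [(QuotientGroup.eq_one_iff a).2 (Subgroup.mem_sup_right ha)]
    exact IsOfFinOrder.one
  have hnd : ¬ Disjoint C (H ⊔ Subgroup.zpowers a) := fun hd =>
    ha (hH.2 hd le_sup_left (Subgroup.mem_sup_right (Subgroup.mem_zpowers a)))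
  rw [Subgroup.disjoint_def] at hnd
  push Not at hnd
  obtain ⟨c, hc, hca, hc1⟩ := hnd
  obtain ⟨h, hh, y, ⟨n, rfl⟩, rfl⟩ := Subgroup.mem_sup.1 hca
  refine isOfFinOrder_iff_zpow_eq_one.2 ⟨n, ?_, ?_⟩
  · rintro rfl
    exact hc1 (Subgroup.disjoint_def.1 hH.1 hc (by simpa using hh))
  · rw [← QuotientGroup.mk_zpow, QuotientGroup.eq_one_iff]
    exact (Subgroup.mul_mem_cancel_left _ (Subgroup.mem_sup_right hh)).1
      (Subgroup.mem_sup_left hc)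

/-- In a finitely generated torsion-free abelian group `A`, every
subgroup `C` is a direct factor of some finite-index subgroup `A₁` of `A`. -/
theorem subgroup_direct_factor_of_finite_index_subgroup
    (A : Type*) [CommGroup A] [Group.FG A]
    (htorsionfree : ∀ a : A, a ≠ 1 → ¬ IsOfFinOrder a)
    (C : Subgroup A) :
    ∃ A₁ : Subgroup A, A₁.FiniteIndex ∧ C ≤ A₁ ∧
      ∃ H : Subgroup A, H ≤ A₁ ∧ C ⊔ H = A₁ ∧ C ⊓ H = ⊥ := by
  obtain ⟨H, hH⟩ := C.exists_maximal_disjoint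
  have : Finite (A ⧸ C ⊔ H) :=
    CommGroup.finite_of_fg_isMulTorsion _ (Subgroup.isTorsion_quotient_sup_of_maximal_disjoint hH)
  exact ⟨C ⊔ H, Subgroup.finiteIndex_of_finite_quotient, le_sup_left, H, le_sup_right, rfl,
    hH.1.eq_bot⟩
end

section
/- Let {A_i | i ∈ I} be a family of groups, let G be their free product (the coproduct in the category of groups), and let π : G → Π_{i ∈ I} A_i be the canonical homomorphism to the direct product induced by the inclusions A_i → Π A_i. Then the kernel of π is a free group. -/
universe u v

open CategoryTheory CategoryTheory.ActionCategory Monoid in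
open Classical in
/-- If a free product acts on `S` and every factor `A i` admits an equivariant map `S → A i`
(equivalently, acts freely), then the action groupoid is free: it is generated by the arrows from
the points of `S` lying over `1 : A i` to the other points of their `A i`-orbits. -/
@[reducible]
noncomputable def isFreeGroupoidOfCoprodIAction {ι : Type u} {A : ι → Type v} [∀ i, Group (A i)]
    {S : Type (max u v)} [MulAction (CoprodI A) S] (τ : ∀ i, S → A i)
    (hτ : ∀ i (a : A i) (s : S), τ i ((CoprodI.of a : CoprodI A) • s) = a * τ i s) :
    IsFreeGroupoid (ActionCategory (CoprodI A) S) where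
  quiverGenerators :=
    ⟨fun x y => { e : Σ i, A i //
      e.2 ≠ 1 ∧ τ e.1 y.back = e.2 ∧ (CoprodI.of e.2 : CoprodI A) • x.back = y.back }⟩
  of := fun (e : Subtype _) => ⟨CoprodI.of e.1.2, e.2.2.2⟩
  unique_lift := by
    intro X _ f
    let c (i : ι) (s : S) : X :=
      if h : τ i s = 1 then 1 else
        @f ⟨(), (CoprodI.of (τ i s) : CoprodI A)⁻¹ • s⟩ ⟨(), s⟩
          ⟨⟨i, τ i s⟩, h, rfl, smul_inv_smul _ s⟩
    let φ (i : ι) : A i →* (S → X) ⋊[mulAutArrow] CoprodI A :=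
      { toFun := fun a =>
          ⟨fun s => c i s * (c i ((CoprodI.of a : CoprodI A)⁻¹ • s))⁻¹, CoprodI.of a⟩
        map_one' := by
          ext s
          · simp
          · simp
        map_mul' := by
          intro a b
          ext s
          · change _ = (c i s * (c i ((CoprodI.of a : CoprodI A)⁻¹ • s))⁻¹) *
              (c i ((CoprodI.of a : CoprodI A)⁻¹ • s) *
                (c i ((CoprodI.of b : CoprodI A)⁻¹ • (CoprodI.of a : CoprodI A)⁻¹ • s))⁻¹)
            simp [mul_smul]
          · simp }
    refine ⟨uncurry (CoprodI.lift φ) ?_, ?_, ?_⟩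
    · suffices SemidirectProduct.rightHom.comp (CoprodI.lift φ) = MonoidHom.id _ by
        exact DFunLike.ext_iff.mp this
      refine CoprodI.ext_hom _ _ fun i => ?_
      ext a
      rw [MonoidHom.comp_assoc, CoprodI.lift_comp_of]
      rfl
    · rintro ⟨⟨⟩, x : S⟩ ⟨⟨⟩, y : S⟩ ⟨⟨i, a⟩, h1, h2, h3⟩
      change (CoprodI.lift φ (CoprodI.of a)).left y = _
      rw [CoprodI.lift_of]
      change τ i y = a at h2
      subst h2
      change _ • x = y at h3
      have hx : x = (CoprodI.of (τ i y) : CoprodI A)⁻¹ • y := eq_inv_smul_iff.mpr h3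
      subst hx
      change c i y * (c i ((CoprodI.of (τ i y) : CoprodI A)⁻¹ • y))⁻¹ = _
      have h4 : τ i ((CoprodI.of (τ i y) : CoprodI A)⁻¹ • y) = 1 := by
        rw [← map_inv, hτ, inv_mul_cancel]
      have h5 : c i ((CoprodI.of (τ i y) : CoprodI A)⁻¹ • y) = 1 := dif_pos h4
      rw [h5, inv_one, mul_one]
      exact dif_neg h1
    · intro E hE
      have key (i : ι) (s : S) : (curry E (CoprodI.of (τ i s))).left s = c i s := by
        by_cases h : τ i s = 1
        · have h5 : c i s = 1 := dif_pos h
          rw [h5, h, map_one, map_one]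
          rfl
        · have h5 : c i s = _ := dif_neg h
          exact (hE _ _ _).trans h5.symm
      have : curry E = CoprodI.lift φ := by
        refine CoprodI.ext_hom _ _ fun i => ?_
        rw [CoprodI.lift_comp_of]
        ext a s
        · change (curry E (CoprodI.of a)).left s =
            c i s * (c i ((CoprodI.of a : CoprodI A)⁻¹ • s))⁻¹
          have h6 : τ i ((CoprodI.of a : CoprodI A)⁻¹ • s) = a⁻¹ * τ i s := by
            rw [← map_inv, hτ]
          rw [eq_mul_inv_iff_mul_eq, ← key, ← key, h6]
          have h7 : CoprodI.of (τ i s) = (CoprodI.of a : CoprodI A) * CoprodI.of (a⁻¹ * τ i s) := by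
            rw [← map_mul, mul_inv_cancel_left]
          rw [h7, (curry E).map_mul]
          rfl
        · rfl
      apply Functor.hext
      · intro
        apply Unit.ext
      · refine ActionCategory.cases fun s g => ?_
        exact heq_of_eq (congrArg (fun F => (F g).left s) this)

open CategoryTheory Monoid in
/-- A subgroup `H` of a free product is free if every factor `A i` admits an equivariant map
from the coset space of `H`. -/
theorem isFreeGroup_of_equivariant_quotient {ι : Type u} {A : ι → Type v} [∀ i, Group (A i)]
    (H : Subgroup (CoprodI A)) (τ : ∀ i, CoprodI A ⧸ H → A i)
    (hτ : ∀ i (a : A i) (s : CoprodI A ⧸ H),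
      τ i ((CoprodI.of a : CoprodI A) • s) = a * τ i s) :
    IsFreeGroup H := by
  let := isFreeGroupoidOfCoprodIAction τ hτ
  have hconn : IsConnected (ActionCategory (CoprodI A) (CoprodI A ⧸ H)) := inferInstance
  have hfree := @IsFreeGroupoid.endIsFreeOfConnectedFree _ _ hconn _
    (ActionCategory.objEquiv (CoprodI A) (CoprodI A ⧸ H) ((1 : CoprodI A) : CoprodI A ⧸ H))
  exact @IsFreeGroup.ofMulEquiv _ _ hfree _ _
    ⟨(ActionCategory.endMulEquivSubgroup H).toEquiv,
      fun a b => (ActionCategory.endMulEquivSubgroup H).map_mul a b⟩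

/-- The kernel of the canonical homomorphism from the free
product of a family of groups to their direct product is a free group. -/
theorem ker_of_coprodI_to_pi_is_free
    (ι : Type*) [DecidableEq ι] (A : ι → Type*) [∀ i, Group (A i)] :
    IsFreeGroup (Monoid.CoprodI.lift (fun i => MonoidHom.mulSingle A i)).ker := by
  refine isFreeGroup_of_equivariant_quotient _ (fun i s => QuotientGroup.kerLift _ s i) ?_
  intro i a s
  induction s using QuotientGroup.induction_on with
  | H g =>
    rw [MulAction.Quotient.smul_coe, QuotientGroup.kerLift_mk, QuotientGroup.kerLift_mk]
    simp
end
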